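/- arXiv:2305.12226 — 3 statements merged into one kernel-verified Lean document; each statement's English description precedes it below -/
import Mathlib

section
/- For all nonzero f, g ∈ A and every integer n ≥ 1, there exist φ, γ ∈ A with φ^n = f, γ^n = g, and such that the n-th power of the ideal of A generated by {φ, γ} equals the ideal of A generated by {f, g}. In particular, every nonzero finitely generated ideal of A has an n-th root among the finitely generated ideals of A. -/
open Polynomial in
theorem aux_lead {R Ω : Type*} [CommRing R] [Field Ω] [Algebra R Ω] (x : Ω)
    (n : ℕ) (a : ℕ → integralClosure R Ω)
    (h : ∑ i ∈ Finset.range (n + 2), (a i : Ω) * x ^ i = 0) :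
    ∃ y : integralClosure R Ω, (y : Ω) = a (n + 1) * x := by
  by_cases h0 : a (n + 1) = 0
  · exact ⟨0, by simp [h0]⟩
  set p : (integralClosure R Ω)[X] := ∑ i ∈ Finset.range (n + 2), C (a i) * X ^ i with hp
  have hc : ∀ j, p.coeff j = if j < n + 2 then a j else 0 := by
    intro j
    simp [hp, Polynomial.finsetSum_coeff, Polynomial.coeff_C_mul, Polynomial.coeff_X_pow]
  have hd : p.natDegree = n + 1 := by
    apply le_antisymm
    · rw [Polynomial.natDegree_le_iff_coeff_eq_zero]
      intro j hj
      rw [hc, if_neg (by omega)]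
    · apply Polynomial.le_natDegree_of_ne_zero
      rw [hc, if_pos (by omega)]; exact h0
  have hl : p.leadingCoeff = a (n + 1) := by
    rw [Polynomial.leadingCoeff, hd, hc, if_pos (by omega)]
  have hx : aeval x p = 0 := by
    rw [hp, map_sum, ← h]
    refine Finset.sum_congr rfl fun i _ => ?_
    rw [map_mul, map_pow, aeval_C, aeval_X]; rfl
  have hi := isIntegral_leadingCoeff_smul p x hx
  have hi2 : IsIntegral R (p.leadingCoeff • x) := isIntegral_trans _ hi
  rw [hl] at hi2
  exact ⟨⟨_, hi2⟩, by rfl⟩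

theorem aux_coeff {R Ω : Type*} [CommRing R] [Field Ω] [Algebra R Ω] (x : Ω) (n : ℕ) :
    ∀ (a : ℕ → integralClosure R Ω)
    (_ : ∑ i ∈ Finset.range (n + 1), (a i : Ω) * x ^ i = 0) (j : ℕ) (_ : j ≤ n),
    ∃ s t s' t' : integralClosure R Ω, a j = s + t ∧ (s' : Ω) = s * x ∧ (t : Ω) = t' * x := by
  induction n with
  | zero =>
    intro a h j hj
    obtain rfl : j = 0 := by omega
    have : a 0 = 0 := by simpa using h
    exact ⟨0, 0, 0, 0, by simp [this], by simp, by simp⟩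
  | succ n ih =>
    intro a h j hj
    obtain ⟨y, hy⟩ := aux_lead x n a h
    have key := ih (Function.update a n (a n + y)) (by
      rw [← h, Finset.sum_range_succ, Finset.sum_range_succ _ (n + 1), Finset.sum_range_succ _ n]
      rw [Finset.sum_congr rfl (g := fun i => (a i : Ω) * x ^ i)]
      · simp [hy]; ring
      · intro i hi
        rw [Function.update_of_ne (by simp at hi; omega)])
    rcases Nat.lt_or_ge n j with hj1 | hj1
    · obtain rfl : j = n + 1 := by omega
      exact ⟨a (n + 1), 0, y, 0, by simp, hy, by simp⟩
    · obtain ⟨s, t, s', t', h1, h2, h3⟩ := key j hj1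
      rcases eq_or_lt_of_le hj1 with rfl | hlt
      · rw [Function.update_self] at h1
        refine ⟨s, t - y, s', t' - a (j + 1), ?_, h2, ?_⟩
        · rw [add_sub, ← h1]; ring
        · push_cast; rw [h3, hy]; ring
      · rw [Function.update_of_ne (by omega)] at h1
        exact ⟨s, t, s', t', h1, h2, h3⟩

open Polynomial in
theorem aux_prim {R : Type*} [CommRing R] [IsDomain R] [IsPrincipalIdealRing R] (p : R[X])
    (hp : p ≠ 0) : ∃ (d : R) (q : R[X]), d ≠ 0 ∧ p = C d * q ∧
      Ideal.span (Set.range q.coeff) = ⊤ := by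
  obtain ⟨d, hd⟩ := (IsPrincipalIdealRing.principal (Ideal.span (Set.range p.coeff))).principal
  rw [Ideal.submodule_span_eq] at hd
  have hdvd : C d ∣ p := by
    rw [C_dvd_iff_dvd_coeff]
    intro i
    rw [← Ideal.mem_span_singleton, ← hd]
    exact Ideal.subset_span ⟨i, rfl⟩
  obtain ⟨q, rfl⟩ := hdvd
  have hd0 : d ≠ 0 := by rintro rfl; simp at hp
  refine ⟨d, q, hd0, rfl, ?_⟩
  have h1 : Ideal.span (Set.range (C d * q).coeff)
      = Ideal.span {d} * Ideal.span (Set.range q.coeff) := by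
    rw [Ideal.span_mul_span']
    congr 1
    ext z
    simp
  have h2 : d ∈ Ideal.span {d} * Ideal.span (Set.range q.coeff) := by
    rw [← h1, hd]; exact Ideal.mem_span_singleton_self d
  rw [Ideal.mem_span_singleton_mul] at h2
  obtain ⟨z, hz, hz2⟩ := h2
  rw [Ideal.eq_top_iff_one]
  rwa [← mul_left_cancel₀ hd0 (hz2.trans (mul_one d).symm)]

open Polynomial in
theorem aux_main {R Ω : Type*} [CommRing R] [IsDomain R] [IsPrincipalIdealRing R]
    [Field Ω] [Algebra R Ω] [FaithfulSMul R Ω] (x : Ω) (hx : IsAlgebraic R x) :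
    ∃ s t s' t' : integralClosure R Ω, 1 = s + t ∧ (s' : Ω) = s * x ∧ (t : Ω) = t' * x := by
  obtain ⟨p, hp, hpx⟩ := hx
  obtain ⟨d, q, hd, rfl, hq⟩ := aux_prim p hp
  have hqx : aeval x q = 0 := by
    rw [map_mul, aeval_C] at hpx
    refine (mul_eq_zero.mp hpx).resolve_left ?_
    exact fun h0 => hd ((FaithfulSMul.algebraMap_eq_zero_iff R Ω).mp h0)
  have hall : ∀ r ∈ Ideal.span (Set.range q.coeff), ∃ s t s' t' : integralClosure R Ω,
      algebraMap R _ r = s + t ∧ (s' : Ω) = s * x ∧ (t : Ω) = t' * x := by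
    intro r hr
    induction hr using Submodule.span_induction with
    | mem r hr =>
      obtain ⟨i, rfl⟩ := hr
      have hs : ∑ i ∈ Finset.range (q.natDegree + 1),
          ((algebraMap R (integralClosure R Ω) (q.coeff i) : integralClosure R Ω) : Ω) * x ^ i
            = 0 := by
        rw [← hqx, aeval_eq_sum_range]
        refine Finset.sum_congr rfl fun i _ => ?_
        rw [Algebra.smul_def]; rfl
      by_cases hi : i ≤ q.natDegree
      · exact aux_coeff x q.natDegree (fun i => algebraMap R _ (q.coeff i)) hs i hi
      · rw [coeff_eq_zero_of_natDegree_lt (by omega)]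
        exact ⟨0, 0, 0, 0, by simp, by simp, by simp⟩
    | zero => exact ⟨0, 0, 0, 0, by simp, by simp, by simp⟩
    | add a b _ _ ha hb =>
      obtain ⟨s, t, s', t', h1, h2, h3⟩ := ha
      obtain ⟨u, v, u', v', h4, h5, h6⟩ := hb
      refine ⟨s + u, t + v, s' + u', t' + v', ?_, ?_, ?_⟩
      · rw [map_add, h1, h4]; ring
      · push_cast; rw [h2, h5]; ring
      · push_cast; rw [h3, h6]; ring
    | smul c a _ ha =>
      obtain ⟨s, t, s', t', h1, h2, h3⟩ := ha
      refine ⟨algebraMap R _ c * s, algebraMap R _ c * t, algebraMap R _ c * s',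
        algebraMap R _ c * t', ?_, ?_, ?_⟩
      · rw [smul_eq_mul, map_mul, h1]; ring
      · push_cast; rw [h2]; ring
      · push_cast; rw [h3]; ring
  have := hall 1 (hq ▸ Submodule.mem_top)
  simpa using this

theorem aux_ideal {A : Type*} [CommRing A] (φ γ s t s' t' : A) (h : 1 = s + t)
    (hs : s * φ = s' * γ) (ht : t * γ = t' * φ) (n : ℕ) :
    (Ideal.span {φ, γ}) ^ n = Ideal.span {φ ^ n, γ ^ n} := by
  apply le_antisymm
  · rw [Ideal.span_insert, ← Ideal.add_eq_sup, add_pow]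
    rw [Ideal.sum_eq_sup, Finset.sup_le_iff]
    intro i hi
    have hi : i ≤ n := by simp at hi; omega
    refine Ideal.mul_le_left.trans ?_
    rw [Ideal.span_singleton_pow, Ideal.span_singleton_pow, Ideal.span_singleton_mul_span_singleton,
      Ideal.span_singleton_le_iff_mem]
    have hc : IsCoprime (s ^ i) (t ^ (n - i)) :=
      IsCoprime.pow ⟨1, 1, by rw [one_mul, one_mul, ← h]⟩
    obtain ⟨u, v, huv⟩ := hc
    rw [Ideal.mem_span_pair]
    obtain ⟨m, rfl⟩ := Nat.exists_eq_add_of_le hi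
    rw [Nat.add_sub_cancel_left] at *
    refine ⟨v * t' ^ m, u * s' ^ i, ?_⟩
    have e1 : s ^ i * φ ^ i = s' ^ i * γ ^ i := by rw [← mul_pow, hs, mul_pow]
    have e2 : t ^ m * γ ^ m = t' ^ m * φ ^ m := by rw [← mul_pow, ht, mul_pow]
    rw [pow_add, pow_add]
    linear_combination (φ ^ i * γ ^ m) * huv - u * γ ^ m * e1 - v * φ ^ i * e2
  · rw [Ideal.span_le]
    rintro z (rfl | rfl)
    · exact Ideal.pow_mem_pow (Ideal.subset_span (by simp)) n
    · exact Ideal.pow_mem_pow (Ideal.subset_span (by simp)) n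


set_option synthInstance.maxHeartbeats 1000000
set_option maxHeartbeats 1000000

/-- Let `A` be the integral closure of `k[t]` in an algebraic closure `Ω` of
`k(t)`, `k` algebraically closed.  For all nonzero `f, g ∈ A` and every `n ≥ 1` there are
`φ, γ ∈ A` with `φ ^ n = f`, `γ ^ n = g` and `(span {φ, γ}) ^ n = span {f, g}`; in particular
every nonzero finitely generated ideal of `A` has an `n`-th root among finitely generated
ideals. -/
theorem exists_nth_root_of_fg_ideal
    (k : Type*) [Field k] [IsAlgClosed k]
    (Ω : Type*) [Field Ω] [Algebra (Polynomial k) Ω] [Algebra (RatFunc k) Ω]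
    [IsScalarTower (Polynomial k) (RatFunc k) Ω] [IsAlgClosure (RatFunc k) Ω]
    (f g : integralClosure (Polynomial k) Ω) (hf : f ≠ 0) (hg : g ≠ 0)
    (n : ℕ) (hn : 1 ≤ n) :
    ∃ φ γ : integralClosure (Polynomial k) Ω, φ ^ n = f ∧ γ ^ n = g ∧
      (Ideal.span {φ, γ} : Ideal (integralClosure (Polynomial k) Ω)) ^ n
        = Ideal.span {f, g} := by
  have : IsAlgClosed Ω := IsAlgClosure.isAlgClosed (RatFunc k)
  have halg : Algebra.IsAlgebraic (RatFunc k) Ω := IsAlgClosure.isAlgebraic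
  have hroot : ∀ f : integralClosure (Polynomial k) Ω,
      ∃ φ : integralClosure (Polynomial k) Ω, φ ^ n = f := by
    intro f
    obtain ⟨z, hz⟩ := IsAlgClosed.exists_pow_nat_eq (f : Ω) (n := n) hn
    have hzi : IsIntegral (Polynomial k) z := IsIntegral.of_pow hn (hz ▸ f.2)
    exact ⟨⟨z, hzi⟩, Subtype.ext hz⟩
  obtain ⟨φ, rfl⟩ := hroot f
  obtain ⟨γ, rfl⟩ := hroot g
  refine ⟨φ, γ, rfl, rfl, ?_⟩
  have hγ : γ ≠ 0 := by
    rintro rfl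
    exact hg (zero_pow (by omega))
  have hγ' : (γ : Ω) ≠ 0 := fun h => hγ (Subtype.ext h)
  have hφ : φ ≠ 0 := by
    rintro rfl
    exact hf (zero_pow (by omega))
  have hinj : Function.Injective (algebraMap (Polynomial k) Ω) := by
    rw [IsScalarTower.algebraMap_eq (Polynomial k) (RatFunc k) Ω]
    exact (algebraMap (RatFunc k) Ω).injective.comp
      (IsFractionRing.injective (Polynomial k) (RatFunc k))
  have : FaithfulSMul (Polynomial k) Ω := (faithfulSMul_iff_algebraMap_injective _ _).mpr hinj
  have hx : IsAlgebraic (Polynomial k) ((φ : Ω) / γ) :=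
    (IsFractionRing.isAlgebraic_iff (Polynomial k) (RatFunc k) Ω).mpr (halg.isAlgebraic _)
  obtain ⟨s, t, s', t', h1, h2, h3⟩ := aux_main _ hx
  refine aux_ideal φ γ s t s' t' h1 (Subtype.ext ?_) (Subtype.ext ?_) n
  · push_cast; rw [h2]; field_simp
  · push_cast; rw [h3]; field_simp
end

section
/- Suppose a and a' are elements of the class group of R such that for every finite set b of maximal ideals of R, if a is supported on b then a' is supported on b. Then a' lies in the ℚ-line spanned by a modulo torsion: there exist integers n ≠ 0 and m with n • a' = m • a in the class group of R. -/
open scoped nonZeroDivisors Classical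

/-- The class of a nonzero ideal `p` of a Dedekind domain in the class group
(by convention the trivial class if `p = 0`). -/
noncomputable def idealClass (R : Type*) [CommRing R] [IsDomain R] [IsDedekindDomain R]
    (p : Ideal R) : ClassGroup R :=
  if h : p ∈ (Ideal R)⁰ then ClassGroup.mk0 ⟨p, h⟩ else 1

/-- A class `c` in the class group of `R` is supported on a finite set `b` of ideals if some
positive multiple `n • c` (written multiplicatively: `c ^ n`) is the class of the fractional
ideal `∏_{p ∈ b} p ^ (m p)` for some integers `m p`. -/
def IsSupportedOn (R : Type*) [CommRing R] [IsDomain R] [IsDedekindDomain R]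
    (c : ClassGroup R) (b : Finset (Ideal R)) : Prop :=
  ∃ n : ℕ, 1 ≤ n ∧ ∃ m : Ideal R → ℤ, c ^ n = ∏ p ∈ b, (idealClass R p) ^ (m p)

set_option linter.overlappingInstances false

lemma avg_aux {C ι : Type*} [CommGroup C] [Fintype ι] (c : ι → C)
    (H : Subgroup (Equiv.Perm ι)) (htr : ∀ i j, ∃ π ∈ H, π i = j) (u : C)
    (hT : ∀ π ∈ H, ∃ T : C →* C, (∀ i, T (c i) = c (π i)) ∧ T u = u)
    (m : ι → ℤ) (hu : u = ∏ i, c i ^ m i) (i₀ : ι) :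
    u ^ (Fintype.card H) = (∏ i, c i) ^ (∑ π : H, m ((π⁻¹ : H).1 i₀)) := by
  have h1 : ∀ π : H, u = ∏ i, c i ^ m ((π⁻¹ : H).1 i) := by
    intro π
    obtain ⟨T, hT1, hT2⟩ := hT π.1 π.2
    calc u = T u := hT2.symm
      _ = ∏ i, c (π.1 i) ^ m i := by
        conv_lhs => rw [hu]
        simp [map_prod, map_zpow, hT1]
      _ = _ := by
        apply Fintype.prod_equiv π.1
        intro i
        simp
  have h2 : ∀ i, ∑ π : H, m ((π⁻¹ : H).1 i) = ∑ π : H, m ((π⁻¹ : H).1 i₀) := by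
    intro i
    obtain ⟨ρ, hρ, rfl⟩ := htr i₀ i
    symm
    apply Fintype.sum_equiv (Equiv.mulLeft (⟨ρ, hρ⟩ : H))
    intro π
    simp
  calc u ^ (Fintype.card H) = ∏ π : H, u := by simp
    _ = ∏ π : H, ∏ i, c i ^ m ((π⁻¹ : H).1 i) := Finset.prod_congr rfl fun π _ => h1 π
    _ = ∏ i, ∏ π : H, c i ^ m ((π⁻¹ : H).1 i) := Finset.prod_comm
    _ = ∏ i, c i ^ (∑ π : H, m ((π⁻¹ : H).1 i)) := by
      refine Finset.prod_congr rfl fun i _ => ?_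
      exact (map_sum (zpowersHom C (c i)).toAdditiveRight _ _).symm
    _ = _ := by simp_rw [h2]; rw [Finset.prod_zpow]

lemma avg {C ι : Type*} [CommGroup C] [Fintype ι] [Nonempty ι] (c : ι → C)
    (H : Subgroup (Equiv.Perm ι)) (htr : ∀ i j, ∃ π ∈ H, π i = j) (a a' : C)
    (hT : ∀ π ∈ H, ∃ T : C →* C, (∀ i, T (c i) = c (π i)) ∧ T a = a ∧ T a' = a')
    (n : ℕ) (hn : 1 ≤ n) (e m : ι → ℤ) (he : ∀ i, 0 < e i)
    (ha : a = ∏ i, c i ^ e i) (ha' : a' ^ n = ∏ i, c i ^ m i) :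
    ∃ n : ℤ, n ≠ 0 ∧ ∃ m : ℤ, a' ^ n = a ^ m := by
  obtain ⟨i₀⟩ := ‹Nonempty ι›
  have h1 := avg_aux c H htr a (fun π hπ => by
    obtain ⟨T, h1, h2, h3⟩ := hT π hπ; exact ⟨T, h1, h2⟩) e ha i₀
  have h2 := avg_aux c H htr (a' ^ n) (fun π hπ => by
    obtain ⟨T, h1, h2, h3⟩ := hT π hπ; exact ⟨T, h1, by rw [map_pow, h3]⟩) m ha' i₀
  set E := ∑ π : H, e ((π⁻¹ : H).1 i₀)
  set M := ∑ π : H, m ((π⁻¹ : H).1 i₀)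
  have hE : 0 < E := Finset.sum_pos (fun π _ => he _) ⟨1, Finset.mem_univ _⟩
  have hc : 0 < Fintype.card H := Fintype.card_pos
  refine ⟨(n * Fintype.card H : ℕ) * E, ?_, (Fintype.card H : ℤ) * M, ?_⟩
  · have : n * Fintype.card H ≠ 0 := by positivity
    exact mul_ne_zero (by exact_mod_cast this) hE.ne'
  · rw [zpow_mul, zpow_natCast, pow_mul, h2, zpow_mul, zpow_natCast, h1, ← zpow_mul, ← zpow_mul,
      mul_comm]

lemma not_isAlgebraic_adjoin {k : Type*} [Field k] (x : ℕ → k) (hx : AlgebraicIndependent ℤ x)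
    (S : Set k) (hS : S.Finite) : ¬ Algebra.IsAlgebraic (Algebra.adjoin ℤ S) k := by
  intro h1
  have h2 : Algebra.trdeg ℤ k ≤ Cardinal.mk S := Algebra.IsAlgebraic.trdeg_le_cardinalMk ℤ S
  have h3 := hx.lift_cardinalMk_le_trdeg
  have h4 : Cardinal.mk S < Cardinal.aleph0 := by
    rw [Cardinal.lt_aleph0_iff_set_finite]; exact hS
  have h5 := h3.trans (Cardinal.lift_le.2 h2)
  simp at h5
  exact absurd h4 (not_lt.2 h5)

lemma isAlgebraic_of_range_le {A A' k : Type*} [CommRing A] [CommRing A'] [CommRing k]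
    [Algebra A k] [Algebra A' k] (hA : Function.Injective (algebraMap A k))
    (hA' : Function.Injective (algebraMap A' k))
    (h : ∀ a : A, ∃ a' : A', algebraMap A' k a' = algebraMap A k a) (y : k)
    (hy : IsAlgebraic A y) : IsAlgebraic A' y := by
  choose i hi using h
  let j : A →+* A' :=
    { toFun := i
      map_one' := hA' (by simp [hi])
      map_mul' := fun a b => hA' (by simp [hi])
      map_zero' := hA' (by simp [hi])
      map_add' := fun a b => hA' (by simp [hi]) }
  refine hy.ringHom_of_comp_eq j (RingHom.id k) ?_ (RingHom.ext hi)
  intro a b hab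
  apply hA
  rw [← hi, ← hi]
  exact congrArg _ hab

lemma exists_field_aux {D k : Type*} [CommRing D] [Field k] [Algebra D k]
    (B : Set k) (hB : IsTranscendenceBasis D ((↑) : B → k)) (t : k) (ht : t ∈ B)
    (k₀ : Subring k)
    (hk₀ : ∀ z, z ∈ k₀ ↔ z ∈ Algebra.adjoin D (Set.image ((↑) : B → k) {⟨t, ht⟩}ᶜ)) :
    Transcendental k₀ t ∧ Algebra.IsAlgebraic (Algebra.adjoin k₀ {t}) k := by
  have hnt : Nontrivial D := (algebraMap D k).domain_nontrivial
  constructor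
  · have h1 := hB.1.transcendental_adjoin (s := {⟨t, ht⟩}ᶜ) (i := ⟨t, ht⟩) (by simp)
    intro h2
    apply h1
    exact isAlgebraic_of_range_le (A := k₀) Subtype.val_injective Subtype.val_injective
      (fun a => ⟨⟨a.1, (hk₀ _).1 a.2⟩, rfl⟩) t h2
  · have h2 := hB.isAlgebraic
    constructor
    intro y
    have h3 := h2.isAlgebraic y
    have hle : ∀ z ∈ Algebra.adjoin D (Set.range ((↑) : B → k)),
        z ∈ Algebra.adjoin k₀ ({t} : Set k) := by
      intro z hz
      induction hz using Algebra.adjoin_induction with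
      | mem z hz =>
        obtain ⟨⟨z, hz⟩, rfl⟩ := hz
        by_cases hzt : z = t
        · subst hzt; exact Algebra.subset_adjoin rfl
        · exact Subalgebra.algebraMap_mem _
            (⟨z, (hk₀ _).2 (Algebra.subset_adjoin ⟨⟨z, hz⟩, by simpa using hzt, rfl⟩)⟩ : k₀)
      | algebraMap r =>
        exact Subalgebra.algebraMap_mem _ (⟨_, (hk₀ _).2 (Subalgebra.algebraMap_mem _ r)⟩ : k₀)
      | add x y _ _ h1 h2 => exact add_mem h1 h2
      | mul x y _ _ h1 h2 => exact mul_mem h1 h2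
    exact isAlgebraic_of_range_le Subtype.val_injective Subtype.val_injective
      (fun a => ⟨⟨a.1, hle _ a.2⟩, rfl⟩) y h3

lemma exists_subring_of_subalgebra {D k : Type*} [CommRing D] [CommRing k] [Algebra D k]
    (A : Subalgebra D k) : ∃ k₀ : Subring k, ∀ z, z ∈ k₀ ↔ z ∈ A :=
  ⟨A.toSubring, fun _ => Subalgebra.mem_toSubring⟩

lemma exists_field_aux2 (D : Type*) {k : Type*} [CommRing D] [Field k] [Algebra D k]
    [FaithfulSMul D k] (hD : ¬ Algebra.IsAlgebraic D k) :
    ∃ (k₀ : Subring k) (t : k), (∀ d, algebraMap D k d ∈ k₀) ∧ Transcendental k₀ t ∧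
      Algebra.IsAlgebraic (Algebra.adjoin k₀ {t}) k := by
  have hnt : Nontrivial D := (algebraMap D k).domain_nontrivial
  obtain ⟨B, hB⟩ := exists_isTranscendenceBasis D k
  have hne : Nonempty B := by
    by_contra hemp
    rw [not_nonempty_iff] at hemp
    exact hD (hB.isEmpty_iff_isAlgebraic.1 hemp)
  obtain ⟨t, ht⟩ := hne
  obtain ⟨k₀, hk₀⟩ := exists_subring_of_subalgebra
    (Algebra.adjoin D (Set.image ((↑) : B → k) {⟨t, ht⟩}ᶜ))
  refine ⟨k₀, t, ?_, exists_field_aux B hB t ht k₀ hk₀⟩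
  intro s
  rw [hk₀]
  exact Subalgebra.algebraMap_mem (Algebra.adjoin D _) s

lemma exists_field {k : Type*} [Field k] (x : ℕ → k) (hx : AlgebraicIndependent ℤ x)
    (S : Set k) (hS : S.Finite) :
    ∃ (k₀ : Subring k) (t : k), S ⊆ k₀ ∧ Transcendental k₀ t ∧
      Algebra.IsAlgebraic (Algebra.adjoin k₀ {t}) k := by
  obtain ⟨k₀, t, h1, h2⟩ := exists_field_aux2 (Algebra.adjoin ℤ S)
    (not_isAlgebraic_adjoin x hx S hS)
  exact ⟨k₀, t, fun s hs => h1 ⟨s, Algebra.subset_adjoin hs⟩, h2⟩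

lemma trdeg_le_one (k R : Type*) [Field k] [CommRing R] [IsDomain R] [IsDedekindDomain R]
    [Algebra k R] [Algebra.FiniteType k R] : Algebra.trdeg k R ≤ 1 := by
  obtain ⟨s, g, hinj, hintegral⟩ := exists_integral_inj_algHom_of_fg k R
  have hs : s ≤ 1 := by
    by_contra hs
    push Not at hs
    let i0 : Fin s := ⟨0, by omega⟩
    let i1 : Fin s := ⟨1, by omega⟩
    have hi : i1 ≠ i0 := by simp [i0, i1]
    let _ : Algebra (MvPolynomial (Fin s) k) R := g.toRingHom.toAlgebra
    have : Algebra.IsIntegral (MvPolynomial (Fin s) k) R := ⟨hintegral⟩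
    let P : Ideal (MvPolynomial (Fin s) k) := Ideal.span {MvPolynomial.X i0}
    have hX0 : (MvPolynomial.X i0 : MvPolynomial (Fin s) k) ≠ 0 := MvPolynomial.X_ne_zero _
    have hP : P.IsPrime := by
      rw [Ideal.span_singleton_prime hX0]
      exact MvPolynomial.X_prime
    obtain ⟨Q, -, hQ, hQP⟩ := Ideal.exists_ideal_over_prime_of_isIntegral P (⊥ : Ideal R) (by
      intro x hx
      have : g x = 0 := hx
      have : x = 0 := hinj (by simpa using this)
      simp [this])
    have hQ0 : Q ≠ ⊥ := by
      rintro rfl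
      have h1 : (MvPolynomial.X i0 : MvPolynomial (Fin s) k) ∈ P := Ideal.subset_span rfl
      rw [← hQP] at h1
      have h2 : g (MvPolynomial.X i0) = 0 := h1
      exact hX0 (hinj (by rw [h2, map_zero]))
    have hQm : Q.IsMaximal := hQ.isMaximal hQ0
    have hPm : P.IsMaximal := by
      rw [← hQP]
      exact Ideal.isMaximal_comap_of_isIntegral_of_isMaximal Q
    have h1 : (MvPolynomial.X i1 : MvPolynomial (Fin s) k) ∉ P := by
      intro h
      rw [Ideal.mem_span_singleton] at h
      obtain ⟨q, hq⟩ := h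
      have := congrArg (MvPolynomial.eval (fun i => if i = i1 then (1:k) else 0)) hq
      simp [hi.symm] at this
    obtain ⟨y, z, hz, hyz⟩ := hPm.exists_inv h1
    rw [Ideal.mem_span_singleton] at hz
    obtain ⟨q, rfl⟩ := hz
    have := congrArg (MvPolynomial.eval (fun _ => (0:k))) hyz
    simp at this
  have hr : Algebra.adjoin k (Set.range fun i => g (MvPolynomial.X i)) = g.range := by
    rw [← Algebra.map_top, ← MvPolynomial.adjoin_range_X, AlgHom.map_adjoin, ← Set.range_comp]
    rfl
  have halg : Algebra.IsAlgebraic (Algebra.adjoin k (Set.range fun i => g (MvPolynomial.X i))) R := by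
    rw [hr]
    constructor
    intro y
    apply IsIntegral.isAlgebraic
    have := hintegral y
    obtain ⟨p, hp, hpy⟩ := this
    refine ⟨p.map g.rangeRestrict.toRingHom, hp.map _, ?_⟩
    rw [Polynomial.eval₂_map]
    exact hpy
  refine (Algebra.IsAlgebraic.trdeg_le_cardinalMk k (Set.range fun i => g (MvPolynomial.X i))).trans ?_
  have : Cardinal.mk (Set.range fun i => g (MvPolynomial.X i)) ≤ s := by
    have := Cardinal.mk_range_le_lift (f := fun i => g (MvPolynomial.X i))
    simpa using this
  refine this.trans ?_
  exact_mod_cast hs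

open Algebra in
lemma not_algInd {k R : Type*} [Field k] [CommRing R] [IsDomain R] [IsDedekindDomain R]
    [Algebra k R] [Algebra.FiniteType k R] (g : R) (hg : g ≠ 0) (u v : Localization.Away g) :
    ¬ AlgebraicIndependent k (fun o : Option Unit => o.elim u (fun _ => v)) := by
  intro h
  have hdom : IsDomain (Localization.Away g) :=
    IsLocalization.isDomain_localization (powers_le_nonZeroDivisors_of_noZeroDivisors hg)
  have hinj : Function.Injective (algebraMap R (Localization.Away g)) :=
    IsLocalization.injective _ (powers_le_nonZeroDivisors_of_noZeroDivisors hg)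
  have : FaithfulSMul R (Localization.Away g) :=
    (faithfulSMul_iff_algebraMap_injective _ _).2 hinj
  have h1 : Algebra.IsAlgebraic R (Localization.Away g) :=
    IsLocalization.isAlgebraic _ (Submonoid.powers g)
  have h2 := trdeg_add_eq k R (A := Localization.Away g)
  rw [trdeg_eq_zero (R := R), add_zero] at h2
  have h3 := h.lift_cardinalMk_le_trdeg
  rw [← h2] at h3
  have h4 := h3.trans (Cardinal.lift_le.2 (trdeg_le_one k R))
  simp at h4

lemma certificate {k B : Type*} [Field k] [CommRing B] [IsDomain B] [Algebra k B] (u φ : B)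
    (hφ : Transcendental k φ)
    (h : ¬ AlgebraicIndependent k (fun o : Option Unit => o.elim u (fun _ => φ))) :
    ∃ S : Set k, S.Finite ∧ ∀ k₀ : Subring k, S ⊆ k₀ → IsAlgebraic (Algebra.adjoin k₀ {φ}) u := by
  rw [algebraicIndependent_iff] at h
  push Not at h
  obtain ⟨P, hP, hP0⟩ := h
  refine ⟨P.coeffs, P.coeffs.finite_toSet, fun k₀ hk₀ => ?_⟩
  have hmem : P ∈ Set.range (MvPolynomial.map k₀.subtype) := by
    rw [MvPolynomial.mem_range_map_iff_coeffs_subset]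
    simpa using hk₀
  obtain ⟨Q, hQ⟩ := hmem
  have hφ0 : Transcendental k₀ φ := 
    hφ.of_ringHom_of_comp_eq k₀.subtype (RingHom.id B) Subtype.val_injective rfl
  have h1 : AlgebraicIndependent k₀ (fun _ : Unit => φ) :=
    algebraicIndependent_unique_type_iff.2 hφ0
  by_contra h2
  have h3 := (h1.option_iff_transcendental u).2 (by rw [Set.range_const]; exact h2)
  have h4 : Q = 0 := by
    apply (algebraicIndependent_iff.1 h3)
    rw [← hP, ← hQ]
    exact (MvPolynomial.aeval_map_algebraMap k _ Q).symm
  apply hP0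
  rw [← hQ, h4, map_zero]

lemma exists_equiv {T A k : Type*} [CommRing T] [CommRing A] [IsDomain A] [Field k]
    [IsAlgClosed k] [Algebra T k]
    [Algebra.IsAlgebraic T k] (hT : Function.Injective (algebraMap T k)) (ψ1 ψ2 : A →+* k)
    (hi1 : Function.Injective ψ1) (hi2 : Function.Injective ψ2)
    (h1 : ∀ s : T, ∃ a, ψ1 a = algebraMap T k s) (h2 : ∀ s : T, ∃ a, ψ2 a = algebraMap T k s) :
    ∃ σ : k ≃+* k, ∀ a, σ (ψ1 a) = ψ2 a := by
  have main : ∀ (K1 K2 : Type _) [Field K1] [Field K2] [Algebra A K1] [Algebra A K2]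
      [IsAlgClosed K1] [IsAlgClosed K2], Function.Injective (algebraMap A K1) →
      Function.Injective (algebraMap A K2) → Algebra.IsAlgebraic A K1 →
      Algebra.IsAlgebraic A K2 → Nonempty (K1 ≃ₐ[A] K2) := by
    intro K1 K2 _ _ _ _ _ _ i1 i2 a1 a2
    have : Module.IsTorsionFree A K1 := Module.isTorsionFree_iff_algebraMap_injective.2 i1
    have : Module.IsTorsionFree A K2 := Module.isTorsionFree_iff_algebraMap_injective.2 i2
    have : IsAlgClosure A K1 := ⟨inferInstance, a1⟩
    have : IsAlgClosure A K2 := ⟨inferInstance, a2⟩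
    exact ⟨IsAlgClosure.equiv A K1 K2⟩
  have halg : ∀ ψ : A →+* k, Function.Injective ψ → (∀ s : T, ∃ a, ψ a = algebraMap T k s) →
      @Algebra.IsAlgebraic A k _ _ ψ.toAlgebra := by
    intro ψ hi h
    let _ := ψ.toAlgebra
    exact ⟨fun y => isAlgebraic_of_range_le (A := T) hT hi h y (Algebra.IsAlgebraic.isAlgebraic y)⟩
  obtain ⟨σ⟩ := @main k k _ _ ψ1.toAlgebra ψ2.toAlgebra _ _ hi1 hi2 (halg ψ1 hi1 h1)
    (halg ψ2 hi2 h2)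
  refine ⟨@AlgEquiv.toRingEquiv A k k _ _ _ ψ1.toAlgebra ψ2.toAlgebra σ, fun a => ?_⟩
  exact @AlgEquiv.commutes A k k _ _ _ ψ1.toAlgebra ψ2.toAlgebra σ a

lemma pts {k B : Type*} [Field k] [IsAlgClosed k] [CommRing B] [IsDomain B] [Algebra k B]
    (k₀ : Subring k) (t : k) (ht : Transcendental k₀ t)
    (halg : Algebra.IsAlgebraic (Algebra.adjoin k₀ {t}) k) (φ : B) (ψ1 ψ2 : B →ₐ[k] k)
    (h1 : ψ1 φ = t) (h2 : ψ2 φ = t) :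
    ∃ σ : k ≃+* k, (∀ c ∈ k₀, σ c = c) ∧ σ t = t ∧
      ∀ y : B, IsAlgebraic (Algebra.adjoin k₀ {φ}) y → σ (ψ1 y) = ψ2 y := by
  let P := Algebra.adjoin k₀ {φ}
  let A0 := Subalgebra.algebraicClosure P B
  have hP : ∀ y : B, y ∈ P → ∃ q : Polynomial k₀, y = Polynomial.aeval φ q := by
    intro y hy
    rw [show P = _ from Algebra.adjoin_singleton_eq_range_aeval k₀ φ] at hy
    obtain ⟨q, hq⟩ := hy
    exact ⟨q, hq.symm⟩
  have hψ : ∀ ψ : B →ₐ[k] k, ψ φ = t → ∀ q : Polynomial k₀,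
      ψ (Polynomial.aeval φ q) = Polynomial.aeval t q := by
    intro ψ h q
    have := Polynomial.aeval_algHom_apply (ψ.restrictScalars k₀) φ q
    rw [← h]
    exact this.symm
  have hPA : ∀ y ∈ P, y ∈ A0 := fun y hy =>
    Subalgebra.algebraMap_mem A0 (⟨y, hy⟩ : P)
  have hinj : ∀ ψ : B →ₐ[k] k, ψ φ = t → Function.Injective (ψ.toRingHom.comp A0.val.toRingHom) := by
    intro ψ h
    rw [injective_iff_map_eq_zero]
    rintro ⟨z, hz⟩ hz0
    by_contra hne
    have hz0 : ψ z = 0 := hz0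
    have hz' : z ≠ 0 := fun h => hne (Subtype.ext h)
    have hz2 : IsAlgebraic P z := hz
    obtain ⟨⟨r, hr⟩, hr0, w, hw⟩ := hz2.exists_nonzero_dvd (mem_nonZeroDivisors_of_ne_zero hz')
    have hw : r = z * w := hw
    have : ψ r = 0 := by rw [hw, map_mul, hz0, zero_mul]
    obtain ⟨q, rfl⟩ := hP r hr
    rw [hψ ψ h] at this
    have : q = 0 := by
      by_contra hq
      exact ht ⟨q, hq, this⟩
    apply hr0
    apply Subtype.ext
    simp [this]
  have hsurj : ∀ ψ : B →ₐ[k] k, ψ φ = t → ∀ s : Algebra.adjoin k₀ {t},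
      ∃ a, (ψ.toRingHom.comp A0.val.toRingHom) a = algebraMap (Algebra.adjoin k₀ {t}) k s := by
    rintro ψ h ⟨s, hs⟩
    have hs' := hs
    rw [Algebra.adjoin_singleton_eq_range_aeval k₀ t] at hs'
    obtain ⟨q, hq⟩ := hs'
    refine ⟨⟨Polynomial.aeval φ q, hPA _ ?_⟩, ?_⟩
    · change _ ∈ Algebra.adjoin k₀ {φ}
      rw [Algebra.adjoin_singleton_eq_range_aeval k₀ φ]
      exact ⟨q, rfl⟩
    · exact (hψ ψ h q).trans hq
  obtain ⟨σ, hσ⟩ := exists_equiv (T := Algebra.adjoin k₀ {t}) (A := A0) Subtype.val_injective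
    _ _ (hinj ψ1 h1) (hinj ψ2 h2) (hsurj ψ1 h1) (hsurj ψ2 h2)
  have hσ' : ∀ y ∈ A0, σ (ψ1 y) = ψ2 y := fun y hy => hσ ⟨y, hy⟩
  refine ⟨σ, ?_, ?_, fun y hy => hσ' y hy⟩
  · intro c hc
    have := hσ' (algebraMap k B c) (hPA _ (Subalgebra.algebraMap_mem P (⟨c, hc⟩ : k₀)))
    simpa using this
  · have := hσ' φ (hPA _ (Algebra.subset_adjoin rfl))
    rwa [h1, h2] at this

/-- automorphisms from field automorphisms -/
lemma exists_tau_aux {k R ι : Type*} [Field k] [CommRing R] [Algebra k R] (x : ι → R)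
    (hsurj : Function.Surjective (MvPolynomial.aeval x : MvPolynomial ι k →ₐ[k] R))
    (G : Set (MvPolynomial ι k))
    (hG : RingHom.ker (MvPolynomial.aeval x : MvPolynomial ι k →ₐ[k] R) = Ideal.span G)
    (σ : k →+* k) (hσ : ∀ P ∈ G, MvPolynomial.map σ P = P) :
    ∃ τ : R →+* R, ∀ P : MvPolynomial ι k, τ (MvPolynomial.aeval x P) =
      MvPolynomial.aeval x (MvPolynomial.map σ P) := by
  let F : MvPolynomial ι k →+* R :=
    (MvPolynomial.aeval x : MvPolynomial ι k →ₐ[k] R).toRingHom.comp (MvPolynomial.map σ)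
  have hF : RingHom.ker (MvPolynomial.aeval x : MvPolynomial ι k →ₐ[k] R).toRingHom ≤ RingHom.ker F := by
    change RingHom.ker (MvPolynomial.aeval x : MvPolynomial ι k →ₐ[k] R) ≤ _
    rw [hG, Ideal.span_le]
    intro P hP
    have h1 : P ∈ RingHom.ker (MvPolynomial.aeval x : MvPolynomial ι k →ₐ[k] R) := by
      rw [hG]; exact Ideal.subset_span hP
    change MvPolynomial.aeval x (MvPolynomial.map σ P) = 0
    rw [hσ P hP]; exact h1
  refine ⟨RingHom.liftOfSurjective (MvPolynomial.aeval x : MvPolynomial ι k →ₐ[k] R).toRingHom hsurj ⟨F, hF⟩, fun P => ?_⟩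
  exact RingHom.liftOfRightInverse_comp_apply _ _ _ ⟨F, hF⟩ P

lemma map_fix {k ι : Type*} [CommRing k] (σ : k →+* k) (P : MvPolynomial ι k)
    (h : ∀ c ∈ P.coeffs, σ c = c) : MvPolynomial.map σ P = P := by
  ext m
  rw [MvPolynomial.coeff_map]
  by_cases hm : P.coeff m = 0
  · simp [hm]
  · exact h _ (MvPolynomial.coeff_mem_coeffs _ hm)

lemma exists_tau {k R ι : Type*} [Field k] [CommRing R] [Algebra k R] (x : ι → R)
    (hsurj : Function.Surjective (MvPolynomial.aeval x : MvPolynomial ι k →ₐ[k] R))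
    (G : Set (MvPolynomial ι k))
    (hG : RingHom.ker (MvPolynomial.aeval x : MvPolynomial ι k →ₐ[k] R) = Ideal.span G)
    (σ : k ≃+* k) (hσ : ∀ P ∈ G, ∀ c ∈ P.coeffs, σ c = c) :
    ∃ τ : R ≃+* R, ∀ P : MvPolynomial ι k, τ (MvPolynomial.aeval x P) =
      MvPolynomial.aeval x (MvPolynomial.map (σ : k →+* k) P) := by
  obtain ⟨τ, hτ⟩ := exists_tau_aux x hsurj G hG (σ : k →+* k) (fun P hP => map_fix _ _ (hσ P hP))
  obtain ⟨τ', hτ'⟩ := exists_tau_aux x hsurj G hG (σ.symm : k →+* k) (fun P hP => map_fix _ _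
    (fun c hc => by
      have := hσ P hP c hc
      change σ.symm c = c
      rw [RingEquiv.symm_apply_eq, this]))
  refine ⟨RingEquiv.ofRingHom τ τ' ?_ ?_, hτ⟩
  · ext r
    obtain ⟨P, rfl⟩ := hsurj r
    change τ (τ' _) = _
    rw [hτ', hτ, MvPolynomial.map_map, RingEquiv.comp_symm, MvPolynomial.map_id]
    rfl
  · ext r
    obtain ⟨P, rfl⟩ := hsurj r
    change τ' (τ _) = _
    rw [hτ, hτ', MvPolynomial.map_map, RingEquiv.symm_comp, MvPolynomial.map_id]
    rfl

lemma class_hom {A B : Type*} [CommRing A] [CommRing B] [IsDomain A] [IsDomain B]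
    [IsDedekindDomain A] [IsDedekindDomain B] (τ : A ≃+* B) :
    ∃ T : ClassGroup A →* ClassGroup B, ∀ (I : Ideal A) (hI : I ∈ (Ideal A)⁰)
      (hI' : I.map τ ∈ (Ideal B)⁰), T (ClassGroup.mk0 ⟨I, hI⟩) = ClassGroup.mk0 ⟨I.map τ, hI'⟩ := by
  let _ := τ.toRingHom.toAlgebra
  have : FaithfulSMul A B := (faithfulSMul_iff_algebraMap_injective _ _).2 τ.injective
  refine ⟨ClassGroup.extendedHom A B, fun I hI hI' => ?_⟩
  rw [ClassGroup.extendedHom_mk0]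
  rfl

lemma exists_point {k R : Type*} [Field k] [IsAlgClosed k] [CommRing R] [Algebra k R]
    [Algebra.FiniteType k R] (p : Ideal R) (hp : p.IsMaximal) :
    ∃ ψ : R →ₐ[k] k, RingHom.ker ψ = p := by
  let _ := Ideal.Quotient.field p
  have : Algebra.FiniteType k (R ⧸ p) := inferInstance
  have : Module.Finite k (R ⧸ p) := finite_of_finite_type_of_isJacobsonRing k (R ⧸ p)
  have hb := IsAlgClosed.algebraMap_bijective_of_isIntegral (k := k) (K := R ⧸ p)
  let e : k ≃ₐ[k] (R ⧸ p) := AlgEquiv.ofBijective (Algebra.ofId k (R ⧸ p)) hb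
  refine ⟨(e.symm : (R ⧸ p) →ₐ[k] k).comp (Ideal.Quotient.mkₐ k p), ?_⟩
  ext r
  simp [RingHom.mem_ker, Ideal.Quotient.eq_zero_iff_mem]

lemma exists_gens (k R : Type*) [Field k] [CommRing R] [Algebra k R] [Algebra.FiniteType k R] :
    ∃ (n : ℕ) (x : Fin n → R),
      Function.Surjective (MvPolynomial.aeval x : MvPolynomial (Fin n) k →ₐ[k] R) := by
  obtain ⟨n, F, hF⟩ := Algebra.FiniteType.iff_quotient_mvPolynomial''.1
    (inferInstance : Algebra.FiniteType k R)
  refine ⟨n, fun i => F (MvPolynomial.X i), ?_⟩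
  have := MvPolynomial.aeval_unique F
  rw [show (fun i => F (MvPolynomial.X i)) = F ∘ MvPolynomial.X from rfl, ← this]
  exact hF

lemma exists_auts {k : Type*} [Field k] [IsAlgClosed k]
    (X : ℕ → k) (hX : AlgebraicIndependent ℤ X)
    {R : Type*} [CommRing R] [IsDomain R] [IsDedekindDomain R]
    [Algebra k R] [Algebra.FiniteType k R] (f g : R) (hg : g ≠ 0)
    (φ : Localization.Away g)
    (hφ : φ * algebraMap R (Localization.Away g) g = - algebraMap R (Localization.Away g) f)
    (hφt : Transcendental k φ) (F : Finset R) (Bad : Set k) (hBad : Bad.Finite) :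
    ∃ t ∉ Bad, ∀ p₁ p₂ : Ideal R, p₁.IsMaximal → p₂.IsMaximal →
      f + algebraMap k R t * g ∈ p₁ → f + algebraMap k R t * g ∈ p₂ → g ∉ p₁ → g ∉ p₂ →
      ∃ τ : R ≃+* R, (∀ r ∈ F, τ r = r) ∧ τ (algebraMap k R t) = algebraMap k R t ∧
        p₁.map τ = p₂ := by
  have hdom : IsDomain (Localization.Away g) :=
    IsLocalization.isDomain_localization (powers_le_nonZeroDivisors_of_noZeroDivisors hg)
  obtain ⟨n, x, hx⟩ := exists_gens k R
  obtain ⟨G, hG⟩ : (RingHom.ker (MvPolynomial.aeval x : MvPolynomial (Fin n) k →ₐ[k] R)).FG :=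
    IsNoetherian.noetherian _
  choose L hL using hx
  choose S hSf hS using fun i => certificate (algebraMap R (Localization.Away g) (x i)) φ hφt
    (not_algInd g hg _ _)
  let GS : Set k := ⋃ P ∈ G, (P.coeffs : Set k)
  let FS : Set k := ⋃ r ∈ F, ((L r).coeffs : Set k)
  let SS : Set k := ⋃ i, S i
  have hGS : GS.Finite := G.finite_toSet.biUnion fun P _ => P.coeffs.finite_toSet
  have hFS : FS.Finite := F.finite_toSet.biUnion fun P _ => (L P).coeffs.finite_toSet
  have hSS : SS.Finite := Set.finite_iUnion hSf
  obtain ⟨k₀, t, hk₀, ht, halg⟩ := exists_field X hX (((GS ∪ FS) ∪ SS) ∪ Bad)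
    (((hGS.union hFS).union hSS).union hBad)
  refine ⟨t, fun htB => ht ?_, ?_⟩
  · exact isAlgebraic_algebraMap (⟨t, hk₀ (Or.inr htB)⟩ : k₀)
  intro p₁ p₂ hp₁ hp₂ h1 h2 hg1 hg2
  obtain ⟨ψ₁, hψ₁⟩ := exists_point (k := k) p₁ hp₁
  obtain ⟨ψ₂, hψ₂⟩ := exists_point (k := k) p₂ hp₂
  have hlift : ∀ (p : Ideal R) (ψ : R →ₐ[k] k), RingHom.ker ψ = p →
      f + algebraMap k R t * g ∈ p → g ∉ p → ∃ Ψ : Localization.Away g →ₐ[k] k,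
        (∀ r, Ψ (algebraMap R _ r) = ψ r) ∧ Ψ φ = t := by
    intro p ψ hψ hf hgp
    rw [← hψ, RingHom.mem_ker] at hf hgp
    have hu : ∀ y : Submonoid.powers g, IsUnit (ψ y) := by
      rintro ⟨_, m, rfl⟩
      simpa using (IsUnit.mk0 _ hgp).pow m
    have hr : ∀ r, (IsLocalization.liftAlgHom (S := Localization.Away g) hu)
        (algebraMap R _ r) = ψ r := fun r => by
      simp
    refine ⟨IsLocalization.liftAlgHom (S := Localization.Away g) hu, hr, ?_⟩
    have := congrArg (IsLocalization.liftAlgHom (S := Localization.Away g) hu) hφ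
    rw [map_mul, map_neg, hr, hr] at this
    rw [map_add, map_mul, AlgHom.commutes] at hf
    apply mul_right_cancel₀ hgp
    rw [this]
    simp at hf ⊢
    linear_combination -hf
  obtain ⟨Ψ₁, hΨ₁, hΨ₁t⟩ := hlift p₁ ψ₁ hψ₁ h1 hg1
  obtain ⟨Ψ₂, hΨ₂, hΨ₂t⟩ := hlift p₂ ψ₂ hψ₂ h2 hg2
  obtain ⟨σ, hσ, hσt, hσy⟩ := pts k₀ t ht halg φ Ψ₁ Ψ₂ hΨ₁t hΨ₂t
  have hσx : ∀ i, σ (ψ₁ (x i)) = ψ₂ (x i) := by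
    intro i
    rw [← hΨ₁, ← hΨ₂]
    apply hσy
    apply hS
    intro c hc
    exact hk₀ (Or.inl (Or.inr (Set.mem_iUnion.2 ⟨i, hc⟩)))
  obtain ⟨τ, hτ⟩ := exists_tau x (fun r => ⟨L r, hL r⟩) (G : Set (MvPolynomial (Fin n) k)) hG.symm σ
    (fun P hP c hc => hσ c (hk₀ (Or.inl (Or.inl (Or.inl (Set.mem_biUnion hP hc))))))
  have hτc : ∀ c, τ (algebraMap k R c) = algebraMap k R (σ c) := by
    intro c
    have := hτ (MvPolynomial.C c)
    simpa using this
  refine ⟨τ, fun r hr => ?_, ?_, ?_⟩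
  · have h := hτ (L r)
    rw [map_fix, hL] at h
    · exact h
    · exact fun c hc => hσ c (hk₀ (Or.inl (Or.inl (Or.inr (Set.mem_biUnion hr hc)))))
  · rw [hτc, hσt]
  · have key : ∀ r, ψ₂ (τ r) = σ (ψ₁ r) := by
      intro r
      rw [← hL r]
      generalize L r = P
      induction P using MvPolynomial.induction_on with
      | C c => simp [hτc]
      | add p q hp hq => rw [map_add, map_add, map_add, map_add, map_add, hp, hq]
      | mul_X p i hp =>
        have hxi : τ (x i) = x i := by
          have := hτ (MvPolynomial.X i)
          simpa using this
        rw [map_mul, map_mul, map_mul, map_mul, map_mul, hp, MvPolynomial.aeval_X, hxi, hσx]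
    have hle : p₁.map τ ≤ p₂ := by
      rw [Ideal.map_le_iff_le_comap]
      intro r hr
      rw [← hψ₁, RingHom.mem_ker] at hr
      rw [Ideal.mem_comap, ← hψ₂, RingHom.mem_ker, key, hr, map_zero]
    have hm : (p₁.map τ).IsMaximal := Ideal.map_isMaximal_of_equiv τ
    exact hm.eq_of_le hp₂.ne_top hle

lemma mem_range_of_isAlgebraic {k B : Type*} [Field k] [IsAlgClosed k] [CommRing B] [IsDomain B]
    [Algebra k B] (y : B) (hy : IsAlgebraic k y) : ∃ c : k, algebraMap k B c = y := by
  have hi : IsIntegral k y := hy.isIntegral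
  exact minpoly.mem_range_of_degree_eq_one k y
    (IsAlgClosed.degree_eq_one_of_irreducible k (minpoly.irreducible hi))

lemma bad_finite {k R : Type*} [Field k] [CommRing R] [IsDomain R] [IsDedekindDomain R]
    [Algebra k R] (f g : R) (hI : Ideal.span {f, g} ≠ ⊥) :
    {t : k | ∃ p : Ideal R, Prime p ∧ p ∣ Ideal.span {f, g} ∧
      f + algebraMap k R t * g ∈ p * Ideal.span {f, g}}.Finite := by
  set I := Ideal.span {f, g} with hIdef
  have hfin : {p : Ideal R | Prime p ∧ p ∣ I}.Finite := by
    refine (UniqueFactorizationMonoid.normalizedFactors I).toFinset.finite_toSet.subset ?_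
    rintro p ⟨hp, hpI⟩
    simp only [Finset.mem_coe, Multiset.mem_toFinset]
    rw [UniqueFactorizationMonoid.mem_normalizedFactors_iff' hI]
    exact ⟨hp.irreducible, normalize_eq _, hpI⟩
  refine (hfin.biUnion (t := fun p => {t : k | f + algebraMap k R t * g ∈ p * I}) ?_).subset ?_
  · rintro p ⟨hp, -⟩
    apply Set.Subsingleton.finite
    intro t₁ h₁ t₂ h₂
    by_contra hne
    simp only [Set.mem_ofPred_eq] at h₁ h₂
    have h3 := sub_mem h₁ h₂
    have h4 : algebraMap k R (t₁ - t₂) * g ∈ p * I := by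
      convert h3 using 1
      rw [map_sub]; ring
    have h5 : g ∈ p * I := by
      have := (p * I).mul_mem_left (algebraMap k R (t₁ - t₂)⁻¹) h4
      rwa [← mul_assoc, ← map_mul, inv_mul_cancel₀ (sub_ne_zero.2 hne), map_one, one_mul] at this
    have h6 : f ∈ p * I := by
      have := sub_mem h₁ ((p * I).mul_mem_left (algebraMap k R t₁) h5)
      simpa using this
    have h7 : I ≤ p * I := by
      rw [hIdef, Ideal.span_le, ← hIdef]
      rintro z (rfl | rfl)
      · exact h6
      · exact h5
    have h8 : p * I ∣ 1 * I := by rw [one_mul]; exact Ideal.dvd_iff_le.2 h7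
    have h9 : p ∣ 1 := (mul_dvd_mul_iff_right hI).1 h8
    exact hp.not_isUnit (isUnit_of_dvd_one h9)
  · rintro t ⟨p, hp, hpI, h⟩
    exact Set.mem_biUnion (show p ∈ {p : Ideal R | Prime p ∧ p ∣ I} from ⟨hp, hpI⟩) h

lemma idealClass_of_ne {R : Type*} [CommRing R] [IsDomain R] [IsDedekindDomain R]
    (p : Ideal R) (hp : p ≠ ⊥) :
    idealClass R p = ClassGroup.mk0 ⟨p, mem_nonZeroDivisors_of_ne_zero hp⟩ :=
  dif_pos _

lemma idealClass_multiset_prod {R : Type*} [CommRing R] [IsDomain R] [IsDedekindDomain R]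
    (s : Multiset (Ideal R)) (hs : ∀ p ∈ s, p ≠ ⊥) :
    idealClass R s.prod = (s.map (idealClass R)).prod := by
  induction s using Multiset.induction_on with
  | empty =>
    rw [Multiset.prod_zero, idealClass_of_ne _ one_ne_zero]
    exact map_one ClassGroup.mk0
  | cons p s ih =>
    have hp : p ≠ ⊥ := hs p (by simp)
    have hs' : ∀ q ∈ s, q ≠ ⊥ := fun q hq => hs q (by simp [hq])
    have hsp : s.prod ≠ ⊥ := by
      have : (0 : Ideal R) ∉ s := fun h => hs' 0 h rfl
      exact Multiset.prod_ne_zero this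
    rw [Multiset.prod_cons, Multiset.map_cons, Multiset.prod_cons, ← ih hs',
      idealClass_of_ne _ hp, idealClass_of_ne _ hsp, idealClass_of_ne _ (mul_ne_zero hp hsp),
      ← map_mul]
    rfl

lemma idealClass_multiset_prod' {R : Type*} [CommRing R] [IsDomain R] [IsDedekindDomain R]
    (s : Multiset (Ideal R)) (hs : ∀ p ∈ s, p ≠ ⊥) :
    idealClass R s.prod = ∏ p ∈ s.toFinset, idealClass R p ^ (s.count p : ℤ) := by
  rw [idealClass_multiset_prod s hs, Finset.prod_multiset_map_count]
  simp only [zpow_natCast]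

lemma exists_factors {R : Type*} [CommRing R] [IsDomain R] [IsDedekindDomain R]
    (J : Ideal R) (hJ0 : J ≠ ⊥) :
    ∃ (b : Finset (Ideal R)) (e : Ideal R → ℤ), (∀ p, p ∈ b ↔ Prime p ∧ p ∣ J) ∧
      (∀ p ∈ b, 0 < e p) ∧ idealClass R J = ∏ p ∈ b, idealClass R p ^ e p := by
  obtain ⟨N, hN⟩ : ∃ N, N = UniqueFactorizationMonoid.normalizedFactors J := ⟨_, rfl⟩
  have hmemb : ∀ p, p ∈ N ↔ Prime p ∧ p ∣ J := by
    intro p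
    rw [hN, UniqueFactorizationMonoid.mem_normalizedFactors_iff' hJ0]
    constructor
    · rintro ⟨h1, -, h2⟩; exact ⟨h1.prime, h2⟩
    · rintro ⟨h1, h2⟩; exact ⟨h1.irreducible, normalize_eq _, h2⟩
  have h1 : N.prod = J := by rw [hN]; exact Ideal.prod_normalizedFactors_eq_self hJ0
  refine ⟨N.toFinset, fun p => N.count p, fun p => ?_, fun p hp => ?_, ?_⟩
  · rw [Multiset.mem_toFinset, hmemb]
  · exact Int.natCast_pos.2 <| Multiset.count_pos.2 (Multiset.mem_toFinset.1 hp)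
  · rw [← idealClass_multiset_prod' N fun p hp => ((hmemb p).1 hp).1.ne_zero, h1]

lemma class_hom' {R : Type*} [CommRing R] [IsDomain R] [IsDedekindDomain R] (τ : R ≃+* R) :
    ∃ T : ClassGroup R →* ClassGroup R, ∀ I : Ideal R, I ≠ ⊥ →
      T (idealClass R I) = idealClass R (I.map τ) := by
  obtain ⟨T, hT⟩ := class_hom τ
  refine ⟨T, fun I hI => ?_⟩
  have hI' : I.map τ ≠ ⊥ := by
    rw [Ne, Ideal.map_eq_bot_iff_of_injective τ.injective]
    exact hI
  rw [idealClass_of_ne I hI, idealClass_of_ne _ hI']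
  exact hT _ _ _

/-- The group of permutations of `b` induced by automorphisms fixing two ideals. -/
def permGroup {R : Type*} [CommRing R] (I I' : Ideal R) (b : Finset (Ideal R)) :
    Subgroup (Equiv.Perm b) where
  carrier := {π | ∃ τ : R ≃+* R, I.map τ = I ∧ I'.map τ = I' ∧ ∀ p : b, p.1.map τ = (π p).1}
  one_mem' := ⟨RingEquiv.refl R, Ideal.map_id _, Ideal.map_id _, fun p => Ideal.map_id _⟩
  mul_mem' := by
    rintro π π' ⟨τ, h1, h2, h3⟩ ⟨τ', h1', h2', h3'⟩
    have hc : ∀ J : Ideal R, J.map (τ'.trans τ) = (J.map τ').map τ := fun J =>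
      (Ideal.map_map (τ' : R →+* R) (τ : R →+* R)).symm
    refine ⟨τ'.trans τ, ?_, ?_, fun p => ?_⟩
    · rw [hc, h1', h1]
    · rw [hc, h2', h2]
    · rw [hc, h3', h3]; rfl
  inv_mem' := by
    rintro π ⟨τ, h1, h2, h3⟩
    have hc : ∀ J : Ideal R, (J.map τ).map τ.symm = J := fun J => Ideal.map_of_equiv τ
    refine ⟨τ.symm, ?_, ?_, fun p => ?_⟩
    · conv_lhs => rw [← h1]
      rw [hc]
    · conv_lhs => rw [← h2]
      rw [hc]
    · have := h3 (π⁻¹ p)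
      rw [show π (π⁻¹ p) = p from π.apply_symm_apply p] at this
      rw [← this, hc]

lemma map_span_pair {R : Type*} [CommRing R] (τ : R ≃+* R) (f g : R) (hf : τ f = f)
    (hg : τ g = g) : (Ideal.span {f, g}).map τ = Ideal.span {f, g} := by
  rw [Ideal.map_span, Set.image_pair, hf, hg]

lemma exists_pair {R : Type*} [CommRing R] [IsDomain R] [IsDedekindDomain R] (c : ClassGroup R) :
    ∃ f g : R, g ≠ 0 ∧ c = idealClass R (Ideal.span {f, g}) := by
  obtain ⟨⟨I, hI⟩, rfl⟩ := ClassGroup.mk0_surjective c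
  have hI0 : I ≠ ⊥ := nonZeroDivisors.ne_zero hI
  obtain ⟨g, hgI, hg⟩ := Submodule.exists_mem_ne_zero_of_ne_bot hI0
  obtain ⟨f, hf⟩ := IsDedekindDomain.exists_eq_span_pair hgI hg
  refine ⟨f, g, hg, ?_⟩
  rw [show Ideal.span {f, g} = I by rw [hf, Set.pair_comm], idealClass_of_ne _ hI0]

/-- Let `k` be an algebraically closed field of infinite transcendence degree
over its prime subfield, and let `R` be a Dedekind domain which is a finitely generated
`k`-algebra (an integral domain) and not a field — the coordinate ring of a smooth affine curve
over `k`.  If `a, a'` are classes in the class group of `R` such that `a'` is supported on every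
finite set of maximal ideals on which `a` is supported, then `a'` lies in the `ℚ`-line spanned
by `a` modulo torsion: `n • a' = m • a` (multiplicatively `a' ^ n = a ^ m`) for some integers
`n ≠ 0` and `m`. -/
theorem class_in_rational_span_of_same_supports
    (k : Type*) [Field k] [IsAlgClosed k]
    (x : ℕ → k) (hx : AlgebraicIndependent ℤ x)
    (R : Type*) [CommRing R] [IsDomain R] [IsDedekindDomain R]
    [Algebra k R] [Algebra.FiniteType k R] (hR : ¬ IsField R)
    (a a' : ClassGroup R)
    (hsupp : ∀ b : Finset (Ideal R), (∀ p ∈ b, p.IsMaximal) →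
      IsSupportedOn R a b → IsSupportedOn R a' b) :
    ∃ n : ℤ, n ≠ 0 ∧ ∃ m : ℤ, a' ^ n = a ^ m := by
  by_cases ha1 : a = 1
  · obtain ⟨n, hn, m, hm⟩ := hsupp ∅ (by simp) ⟨1, le_rfl, 0, by simp [ha1]⟩
    refine ⟨n, by omega, 0, ?_⟩
    simpa using hm
  obtain ⟨f, g, hg, hfg⟩ := exists_pair a⁻¹
  obtain ⟨f', g', hg', hfg'⟩ := exists_pair a'
  set I := Ideal.span {f, g} with hIdef
  set I' := Ideal.span {f', g'} with hIdef'
  have hgI : g ∈ I := Ideal.subset_span (by simp)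
  have hfI : f ∈ I := Ideal.subset_span (by simp)
  have hI0 : I ≠ ⊥ := fun h => hg (by rw [h] at hgI; simpa using hgI)
  have hI0' : I' ≠ ⊥ := fun h => hg' (by
    have : g' ∈ I' := Ideal.subset_span (by simp)
    rw [h] at this; simpa using this)
  have hprinc : ∀ c : k, f ≠ algebraMap k R c * g := by
    intro c hc
    apply ha1
    have h1 : I = Ideal.span {g} := by
      apply le_antisymm
      · rw [hIdef, Ideal.span_le]
        rintro z (rfl | rfl)
        · rw [hc]; exact Ideal.mul_mem_left _ _ (Ideal.subset_span rfl)
        · exact Ideal.subset_span rfl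
      · rw [Ideal.span_singleton_le_iff_mem]; exact hgI
    have h2 : a⁻¹ = 1 := by
      rw [hfg, idealClass_of_ne _ hI0, ClassGroup.mk0_eq_one_iff]
      change I.IsPrincipal
      rw [h1]
      exact ⟨g, rfl⟩
    exact inv_eq_one.1 h2
  have hdom : IsDomain (Localization.Away g) :=
    IsLocalization.isDomain_localization (powers_le_nonZeroDivisors_of_noZeroDivisors hg)
  have hinj : Function.Injective (algebraMap R (Localization.Away g)) :=
    IsLocalization.injective _ (powers_le_nonZeroDivisors_of_noZeroDivisors hg)
  obtain ⟨φ, hφ⟩ : ∃ φ : Localization.Away g,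
      φ * algebraMap R (Localization.Away g) g = - algebraMap R (Localization.Away g) f :=
    ⟨- algebraMap R (Localization.Away g) f * IsLocalization.Away.invSelf g, by
      rw [mul_assoc, mul_comm (IsLocalization.Away.invSelf g), IsLocalization.Away.mul_invSelf,
        mul_one]⟩
  have hφt : Transcendental k φ := by
    intro h
    obtain ⟨c, rfl⟩ := mem_range_of_isAlgebraic φ h
    apply hprinc (-c)
    apply hinj
    rw [map_mul, ← IsScalarTower.algebraMap_apply, map_neg, neg_mul, hφ, neg_neg]
  obtain ⟨t, htB, hτ⟩ := exists_auts x hx f g hg φ hφ hφt {f, g, f', g'} _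
    (bad_finite (k := k) f g hI0)
  set h := f + algebraMap k R t * g with hh
  have hh0 : h ≠ 0 := by
    intro h0
    apply hprinc (-t)
    rw [map_neg]
    linear_combination h0
  have hhI : h ∈ I := add_mem hfI (I.mul_mem_left _ hgI)
  obtain ⟨J, hJ⟩ : I ∣ Ideal.span {h} := by
    rw [Ideal.dvd_iff_le, Ideal.span_singleton_le_iff_mem]; exact hhI
  have hJ0 : J ≠ ⊥ := by
    rintro rfl
    rw [Ideal.mul_bot, Ideal.span_singleton_eq_bot] at hJ
    exact hh0 hJ
  have haJ : a = idealClass R J := by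
    have h1 : idealClass R I * idealClass R J = 1 := by
      rw [idealClass_of_ne _ hI0, idealClass_of_ne _ hJ0, ← map_mul, ClassGroup.mk0_eq_one_iff]
      change (I * J).IsPrincipal
      rw [← hJ]
      exact ⟨h, rfl⟩
    rw [← hfg] at h1
    exact (inv_mul_eq_one.1 h1)
  obtain ⟨b, e, hmemb, he, hJprod⟩ := exists_factors J hJ0
  have hmax : ∀ p ∈ b, p.IsMaximal := by
    intro p hp
    have := ((hmemb p).1 hp).1
    exact (Ideal.isPrime_of_prime this).isMaximal this.ne_zero
  have hpt : ∀ p ∈ b, h ∈ p ∧ g ∉ p := by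
    intro p hp
    obtain ⟨hpp, hpJ⟩ := (hmemb p).1 hp
    have h1 : h ∈ p * I := by
      rw [← Ideal.span_singleton_le_iff_mem, hJ, mul_comm p I]
      exact Ideal.mul_mono_right (Ideal.dvd_iff_le.1 hpJ)
    have h2 : h ∈ p := (Ideal.mul_le_left : p * I ≤ p) h1
    refine ⟨h2, fun hgp => htB ⟨p, hpp, ?_, h1⟩⟩
    rw [Ideal.dvd_iff_le, Ideal.span_le]
    rintro z (rfl | rfl)
    · have := sub_mem h2 (p.mul_mem_left (algebraMap k R t) hgp)
      simpa [hh] using this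
    · exact hgp
  have hprod : a = ∏ p ∈ b, idealClass R p ^ e p := haJ.trans hJprod
  obtain ⟨n, hn, m, hm⟩ := hsupp b hmax ⟨1, le_rfl, e, by rw [pow_one]; exact hprod⟩
  have hne : Nonempty b := by
    by_contra hemp
    rw [not_nonempty_iff, Finset.isEmpty_coe_sort] at hemp
    apply ha1
    rw [hprod, hemp, Finset.prod_empty]
  refine avg (ι := b) (fun p => idealClass R p.1) (permGroup I I' b) ?_ a a' ?_ n hn
    (fun p => e p.1) (fun p => m p.1) ?_ ?_ ?_
  · intro p q
    obtain ⟨τ, h1, h2, h3⟩ := hτ p.1 q.1 (hmax _ p.2) (hmax _ q.2) (hpt _ p.2).1 (hpt _ q.2).1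
      (hpt _ p.2).2 (hpt _ q.2).2
    have hτf : τ f = f := h1 f (by simp)
    have hτg : τ g = g := h1 g (by simp)
    have hτI : I.map τ = I := map_span_pair τ f g hτf hτg
    have hτI' : I'.map τ = I' := map_span_pair τ f' g' (h1 f' (by simp)) (h1 g' (by simp))
    have hτJ : J.map τ = J := by
      apply mul_left_cancel₀ hI0
      conv_lhs => rw [← hτI]
      rw [← Ideal.map_mul, ← hJ, Ideal.map_span, Set.image_singleton, hh, map_add, map_mul, h2,
        hτf, hτg]
    have hc : ∀ K : Ideal R, (K.map τ).map τ.symm = K := fun K => Ideal.map_of_equiv τ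
    have hc' : ∀ K : Ideal R, (K.map τ.symm).map τ = K := fun K => Ideal.map_of_equiv τ.symm
    have hτJ' : J.map τ.symm = J := by
      conv_lhs => rw [← hτJ]
      rw [hc]
    have hbmem : ∀ (ρ : R ≃+* R), J.map ρ = J → ∀ p ∈ b, p.map ρ ∈ b := by
      intro ρ hρ p hp
      obtain ⟨hpp, hpJ⟩ := (hmemb p).1 hp
      rw [hmemb]
      constructor
      · have := Ideal.isPrime_of_prime hpp
        refine Ideal.prime_of_isPrime ?_ (Ideal.map_isPrime_of_equiv ρ)
        rw [Ne, Ideal.map_eq_bot_iff_of_injective ρ.injective]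
        exact hpp.ne_zero
      · rw [Ideal.dvd_iff_le] at hpJ ⊢
        rw [← hρ]
        exact Ideal.map_mono hpJ
    refine ⟨⟨fun p => ⟨p.1.map τ, hbmem τ hτJ _ p.2⟩,
      fun p => ⟨p.1.map τ.symm, hbmem τ.symm hτJ' _ p.2⟩, fun p => Subtype.ext (hc _),
      fun p => Subtype.ext (hc' _)⟩, ⟨τ, hτI, hτI', fun p => rfl⟩, Subtype.ext h3⟩
  · rintro π ⟨τ, h1, h2, h3⟩
    obtain ⟨T, hT⟩ := class_hom' τ
    refine ⟨T, fun p => ?_, ?_, ?_⟩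
    · rw [hT _ ((hmemb _).1 p.2).1.ne_zero, h3]
    · apply inv_injective
      rw [← map_inv, hfg, hT _ hI0, h1]
    · rw [hfg', hT _ hI0', h2]
  · exact fun p => he p.1 p.2
  · rw [hprod]
    exact (Finset.prod_coe_sort b (fun p => idealClass R p ^ e p)).symm
  · rw [hm]
    exact (Finset.prod_coe_sort b (fun p => idealClass R p ^ (m p))).symm
end

section
/- Every nonzero finitely generated ideal I of A is invertible: there exists a fractional ideal J of A (inside the fraction field of A) with I·J = A. -/
open scoped nonZeroDivisors

set_option synthInstance.maxHeartbeats 1000000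
set_option maxHeartbeats 1000000

open Polynomial in
/-- `W + x W`, where `W` is the set of integral `u` with `x u` integral. -/
def condSub (R : Type*) [CommRing R] {L : Type*} [Field L] [Algebra R L] (x : L) :
    Submodule R L where
  carrier := {z | ∃ u v : L, IsIntegral R u ∧ IsIntegral R v ∧ IsIntegral R (x * u) ∧
    IsIntegral R (x * v) ∧ z = u + x * v}
  zero_mem' := ⟨0, 0, by simp [isIntegral_zero]⟩
  add_mem' := by
    rintro _ _ ⟨u, v, hu, hv, hxu, hxv, rfl⟩ ⟨u', v', hu', hv', hxu', hxv', rfl⟩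
    refine ⟨u + u', v + v', hu.add hu', hv.add hv', ?_, ?_, by ring⟩
    · rw [mul_add]; exact hxu.add hxu'
    · rw [mul_add]; exact hxv.add hxv'
  smul_mem' := by
    rintro r _ ⟨u, v, hu, hv, hxu, hxv, rfl⟩
    refine ⟨r • u, r • v, hu.smul r, hv.smul r, ?_, ?_, by rw [smul_add, mul_smul_comm]⟩
    · rw [mul_smul_comm]; exact hxu.smul r
    · rw [mul_smul_comm]; exact hxv.smul r

open Polynomial in
theorem coeff_mem_condSub (R : Type*) [CommRing R] {L : Type*} [Field L] [Algebra R L] (x : L)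
    (n : ℕ) : ∀ f : (integralClosure R L)[X], f.natDegree ≤ n → aeval x f = 0 →
      ∀ i, ((f.coeff i : integralClosure R L) : L) ∈ condSub R x := by
  induction n with
  | zero =>
    intro f hf h i
    obtain ⟨c, rfl⟩ := natDegree_eq_zero.mp (Nat.le_zero.mp hf)
    rw [aeval_C] at h
    have : c = 0 := by
      apply Subtype.ext
      exact h
    subst this
    simp
  | succ n ih =>
    intro f hf h i
    rcases Nat.lt_or_ge f.natDegree (n + 1) with hlt | hge
    · exact ih f (by omega) h i
    have hd : f.natDegree = n + 1 := le_antisymm hf hge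
    have hint : IsIntegral R (f.leadingCoeff • x) :=
      isIntegral_trans _ (isIntegral_leadingCoeff_smul f x h)
    have hsm : f.leadingCoeff • x = x * (f.leadingCoeff : L) := by
      rw [Algebra.smul_def, mul_comm]; rfl
    rw [hsm] at hint
    have hc : IsIntegral R (f.leadingCoeff : L) := f.leadingCoeff.2
    let y : integralClosure R L := ⟨x * (f.leadingCoeff : L), hint⟩
    have hy : (y : L) ∈ condSub R x :=
      ⟨0, f.leadingCoeff, isIntegral_zero, hc, by simp [isIntegral_zero], hint, by simp [y]⟩
    have hcm : (f.leadingCoeff : L) ∈ condSub R x :=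
      ⟨f.leadingCoeff, 0, hc, isIntegral_zero, hint, by simp [isIntegral_zero], by simp⟩
    have key := ih (f.eraseLead + monomial n y) ?_ ?_ i
    · by_cases hi : i = n + 1
      · subst hi
        rw [← hd]; exact hcm
      · rw [coeff_add, eraseLead_coeff_of_ne _ (by omega), coeff_monomial] at key
        split_ifs at key with hin
        · have := (condSub R x).sub_mem key hy
          simpa using this
        · simpa using key
    · refine (natDegree_add_le _ _).trans (max_le ?_ (natDegree_monomial_le _))
      have := eraseLead_natDegree_le f
      omega
    · have h2 := h
      rw [← eraseLead_add_monomial_natDegree_leadingCoeff f, map_add, aeval_monomial, hd] at h2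
      rw [map_add, aeval_monomial, ← h2]
      congr 1
      change x * (f.leadingCoeff : L) * x ^ n = (f.leadingCoeff : L) * x ^ (n + 1)
      ring

open Polynomial in
theorem one_mem_condSub (R : Type*) [CommRing R] [IsDomain R] [IsPrincipalIdealRing R]
    {L : Type*} [Field L] [Algebra R L] (hinj : Function.Injective (algebraMap R L)) (x : L)
    (hx : IsAlgebraic R x) : (1 : L) ∈ condSub R x := by
  obtain ⟨p, hp, hpx⟩ := hx
  have hprin : p.contentIdeal.IsPrincipal := inferInstance
  obtain ⟨q, hq⟩ := hprin.contentIdeal_generator_dvd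
  set d := hprin.generator with hd
  have hd0 : d ≠ 0 := by
    intro h0
    rw [h0] at hq
    simp at hq
    exact hp hq
  have hqx : aeval x q = 0 := by
    rw [hq, map_mul, aeval_C] at hpx
    exact (mul_eq_zero.mp hpx).resolve_left fun h =>
      hd0 (hinj (by rw [h, map_zero]))
  have hqtop : q.contentIdeal = ⊤ := by
    rw [← isPrimitive_iff_contentIdeal_eq_top]
    intro r hr
    have h1 : C (d * r) ∣ p := by
      rw [hq, C_mul]; exact mul_dvd_mul_left _ hr
    rw [← hprin.contentIdeal_le_span_iff_dvd, ← p.contentIdeal.span_singleton_generator,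
      Ideal.span_singleton_le_span_singleton] at h1
    obtain ⟨s, hs⟩ := h1
    refine IsUnit.of_mul_eq_one s (mul_left_cancel₀ hd0 ?_)
    rw [mul_one, ← mul_assoc]; exact hs.symm
  have hle : q.contentIdeal ≤ (condSub R x).comap (Algebra.linearMap R L) := by
    rw [contentIdeal_def, Ideal.span, Submodule.span_le]
    intro r hr
    obtain ⟨n, _, rfl⟩ := mem_coeffs_iff.mp hr
    have := coeff_mem_condSub R x _ (q.map (algebraMap R (integralClosure R L))) le_rfl
      (by rw [aeval_map_algebraMap]; exact hqx) n
    rw [coeff_map] at this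
    exact this
  have := hle (hqtop ▸ Submodule.mem_top : (1 : R) ∈ q.contentIdeal)
  simpa using this

/-- Two elements generate an ideal dividing a nonzero principal ideal. -/
theorem pair_dvd (R : Type*) [CommRing R] [IsDomain R] [IsPrincipalIdealRing R]
    {L : Type*} [Field L] [Algebra R L] (hinj : Function.Injective (algebraMap R L))
    (halg : ∀ x : L, IsAlgebraic R x) (a b : integralClosure R L) (hb : b ≠ 0) :
    ∃ J : Ideal (integralClosure R L), Ideal.span {a, b} * J = Ideal.span {b} := by
  have hb' : (b : L) ≠ 0 := fun h => hb (Subtype.ext h)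
  obtain ⟨u, v, hu, hv, hxu, hxv, h1⟩ := one_mem_condSub R hinj ((a : L) / b) (halg _)
  let u' : integralClosure R L := ⟨u, hu⟩
  let v' : integralClosure R L := ⟨v, hv⟩
  let w' : integralClosure R L := ⟨_, hxu⟩
  let z' : integralClosure R L := ⟨_, hxv⟩
  have e1 : a * u' = b * w' := by
    apply Subtype.ext
    change (a : L) * u = b * (a / b * u)
    field_simp
  have e2 : a * v' = b * z' := by
    apply Subtype.ext
    change (a : L) * v = b * (a / b * v)
    field_simp
  have e3 : 1 = u' + z' := Subtype.ext h1
  refine ⟨Ideal.span {u', v'}, le_antisymm ?_ ?_⟩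
  · rw [Ideal.span_mul_span', Ideal.span_le]
    rintro _ ⟨p, hp, q, hq, rfl⟩
    simp only [SetLike.mem_coe, Ideal.mem_span_singleton]
    rcases hp with rfl | rfl <;> rcases hq with rfl | rfl
    · exact ⟨_, e1⟩
    · exact ⟨_, e2⟩
    · exact ⟨_, rfl⟩
    · exact ⟨_, rfl⟩
  · rw [Ideal.span_singleton_le_iff_mem]
    have : b = b * u' + a * v' := by rw [e2, ← mul_add, ← e3, mul_one]
    have hm : b * u' + a * v' ∈ Ideal.span {a, b} * Ideal.span {u', v'} := by
      refine Ideal.add_mem _ (Ideal.mul_mem_mul ?_ ?_) (Ideal.mul_mem_mul ?_ ?_) <;>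
        exact Ideal.subset_span (by simp)
    rwa [← this] at hm

theorem three_ideals {A : Type*} [CommRing A] (I J K : Ideal A) :
    (I ⊔ J ⊔ K) * (I * J ⊔ J * K ⊔ K * I) = (I ⊔ J) * (J ⊔ K) * (I ⊔ K) := by
  simp only [← Ideal.add_eq_sup]
  have h : I * J * K + I * J * K = I * J * K := by rw [Ideal.add_eq_sup, sup_idem]
  calc _ = (I + J) * (J + K) * (I + K) + I * J * K := by ring
    _ = I * I * J + I * I * K + J * J * I + J * J * K + K * K * I + K * K * J +
        (I * J * K + I * J * K + I * J * K) := by ring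
    _ = I * I * J + I * I * K + J * J * I + J * J * K + K * K * I + K * K * J +
        (I * J * K + I * J * K) := by rw [h, h]
    _ = _ := by ring

theorem list_dvd {A : Type*} [CommRing A] [IsDomain A]
    (h2 : ∀ a b : A, b ≠ 0 → ∃ J : Ideal A, Ideal.span {a, b} * J = Ideal.span {b})
    (n : ℕ) : ∀ l : List A, l.length = n → Ideal.ofList l ≠ ⊥ →
      ∃ (J : Ideal A) (d : A), d ≠ 0 ∧ Ideal.ofList l * J = Ideal.span {d} := by
  induction n using Nat.strong_induction_on with
  | _ n ih =>
    intro l hl hne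
    match l, hl, hne with
    | [], _, hne => simp at hne
    | [a], _, hne =>
      refine ⟨⊤, a, ?_, by simp⟩
      rintro rfl
      simp at hne
    | a :: b :: l, hl, hne =>
      simp only [List.length_cons] at hl
      by_cases ha : a = 0
      · subst ha
        have e : Ideal.ofList ((0 : A) :: b :: l) = Ideal.ofList (b :: l) := by
          rw [Ideal.ofList_cons]; simp
        rw [e] at hne ⊢
        exact ih (l.length + 1) (by omega) _ (by simp) hne
      by_cases hb : b = 0
      · subst hb
        have e : Ideal.ofList (a :: (0 : A) :: l) = Ideal.ofList (a :: l) := by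
          simp [Ideal.ofList_cons]
        rw [e] at hne ⊢
        exact ih (l.length + 1) (by omega) _ (by simp) hne
      have ne : ∀ c : A, c ≠ 0 → Ideal.ofList (c :: l) ≠ ⊥ := by
        intro c hc h
        rw [Ideal.ofList_cons, sup_eq_bot_iff, Ideal.span_singleton_eq_bot] at h
        exact hc h.1
      obtain ⟨J1, hJ1⟩ := h2 a b hb
      obtain ⟨J2, d2, hd2, hJ2⟩ := ih (l.length + 1) (by omega) (b :: l) (by simp) (ne b hb)
      obtain ⟨J3, d3, hd3, hJ3⟩ := ih (l.length + 1) (by omega) (a :: l) (by simp) (ne a ha)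
      rw [Ideal.span_insert] at hJ1
      rw [Ideal.ofList_cons] at hJ2 hJ3
      refine ⟨(Ideal.span {a} * Ideal.span {b} ⊔ Ideal.span {b} * Ideal.ofList l ⊔
        Ideal.ofList l * Ideal.span {a}) * (J1 * J2 * J3), b * d2 * d3,
        mul_ne_zero (mul_ne_zero hb hd2) hd3, ?_⟩
      rw [Ideal.ofList_cons, Ideal.ofList_cons, ← sup_assoc, ← mul_assoc, three_ideals,
        ← Ideal.span_singleton_mul_span_singleton, ← Ideal.span_singleton_mul_span_singleton,
        ← hJ2, ← hJ3]
      refine Eq.trans ?_ (congrArg (fun X => X * _ * _) hJ1)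
      ac_rfl

/-- Let `A` be the integral closure of `k[t]` in an algebraic closure `Ω` of
`k(t)`, `k` algebraically closed.  Every nonzero finitely generated ideal `I` of `A` is
invertible: there is a fractional ideal `J` of `A` with `I * J = A`. -/
theorem fg_ideal_invertible
    (k : Type*) [Field k] [IsAlgClosed k]
    (Ω : Type*) [Field Ω] [Algebra (Polynomial k) Ω] [Algebra (RatFunc k) Ω]
    [IsScalarTower (Polynomial k) (RatFunc k) Ω] [IsAlgClosure (RatFunc k) Ω]
    (I : Ideal (integralClosure (Polynomial k) Ω)) (hI : I ≠ ⊥) (hfg : I.FG) :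
    ∃ J : FractionalIdeal (integralClosure (Polynomial k) Ω)⁰
        (FractionRing (integralClosure (Polynomial k) Ω)),
      (I : FractionalIdeal (integralClosure (Polynomial k) Ω)⁰
        (FractionRing (integralClosure (Polynomial k) Ω))) * J = 1 := by
  have hinj : Function.Injective (algebraMap (Polynomial k) Ω) := by
    rw [IsScalarTower.algebraMap_eq (Polynomial k) (RatFunc k) Ω]
    exact (algebraMap (RatFunc k) Ω).injective.comp (IsFractionRing.injective _ _)
  have halgK : Algebra.IsAlgebraic (RatFunc k) Ω := IsAlgClosure.isAlgebraic
  have halg : ∀ x : Ω, IsAlgebraic (Polynomial k) x := fun x =>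
    (IsFractionRing.isAlgebraic_iff (Polynomial k) (RatFunc k) Ω).mpr (halgK.isAlgebraic x)
  obtain ⟨s, hs⟩ := hfg
  have hl : Ideal.ofList s.toList = I := by
    rw [← hs, Ideal.ofList]
    simp
  obtain ⟨J, d, hd, hJ⟩ := list_dvd (fun a b hb => pair_dvd (Polynomial k) hinj halg a b hb)
    _ s.toList rfl (by rw [hl]; exact hI)
  rw [hl] at hJ
  refine ⟨(J : FractionalIdeal (integralClosure (Polynomial k) Ω)⁰
        (FractionRing (integralClosure (Polynomial k) Ω))) *
        FractionalIdeal.spanSingleton _ (algebraMap _ _ d)⁻¹, ?_⟩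
  rw [← mul_assoc, ← FractionalIdeal.coeIdeal_mul, hJ, FractionalIdeal.coeIdeal_span_singleton,
    FractionalIdeal.spanSingleton_mul_spanSingleton, mul_inv_cancel₀,
    FractionalIdeal.spanSingleton_one]
  exact fun h => hd ((IsFractionRing.injective _ _) (h.trans (map_zero _).symm))
end
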